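/- For a fixed c ∈ ℭ_+, there exists ε > 0 such that for every pair (P, Q) ∈ (𝔓̄_+ \ {0}) × (𝔓̄_+ \ {0}) one has J_P(Q) ≥ ε ‖Q‖_∞ − (∫_{𝕋^d} P dm) · log ‖Q‖_∞, where ‖Q‖_∞ := sup_{θ∈𝕋^d} |Q(e^{iθ})|. -/

import Mathlib

open MeasureTheory Complex Set

noncomputable section

namespace RCE

/-- The scalar product (k,θ) = Σⱼ kⱼ θⱼ. -/
def dotP (d : ℕ) (k : Fin d → ℤ) (θ : Fin d → ℝ) : ℝ := ∑ j, (k j : ℝ) * θ j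

/-- The d-dimensional torus 𝕋^d = (−π,π]^d. -/
def Td (d : ℕ) : Set (Fin d → ℝ) := Set.univ.pi fun _ => Set.Ioc (-Real.pi) Real.pi

/-- Normalized Lebesgue measure dm = (2π)^{-d} dθ on 𝕋^d. -/
def dm (d : ℕ) : Measure (Fin d → ℝ) :=
  (ENNReal.ofReal ((2 * Real.pi) ^ d))⁻¹ • (volume.restrict (Td d))

/-- Conjugate-symmetric coefficient sequences supported on Λ. -/
def IsCoeff (d : ℕ) (Λ : Finset (Fin d → ℤ)) (p : (Fin d → ℤ) → ℂ) : Prop :=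
  (∀ k, k ∉ Λ → p k = 0) ∧ ∀ k, p (-k) = starRingEnd ℂ (p k)

/-- Evaluation of the (real-valued) trigonometric polynomial
`P(e^{iθ}) = Σ_{k∈Λ} p_k e^{-i(k,θ)}`. -/
def eval (d : ℕ) (Λ : Finset (Fin d → ℤ)) (p : (Fin d → ℤ) → ℂ) (θ : Fin d → ℝ) : ℝ :=
  (∑ k ∈ Λ, p k * Complex.exp (-(dotP d k θ : ℂ) * Complex.I)).re

/-- `𝔓̄₊` : the closed cone of nonnegative trigonometric polynomials. -/
def Pbar (d : ℕ) (Λ : Finset (Fin d → ℤ)) : Set ((Fin d → ℤ) → ℂ) :=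
  {p | IsCoeff d Λ p ∧ ∀ θ ∈ Td d, 0 ≤ eval d Λ p θ}

/-- `𝔓₊` : the open cone of positive trigonometric polynomials. -/
def Pplus (d : ℕ) (Λ : Finset (Fin d → ℤ)) : Set ((Fin d → ℤ) → ℂ) :=
  {p | IsCoeff d Λ p ∧ ∀ θ ∈ Td d, 0 < eval d Λ p θ}

/-- The pairing ⟨c,p⟩ = Σ_{k∈Λ} c_k conj(p_k) (real-valued by conjugate symmetry). -/
def pair (d : ℕ) (Λ : Finset (Fin d → ℤ)) (c p : (Fin d → ℤ) → ℂ) : ℝ :=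
  (∑ k ∈ Λ, c k * starRingEnd ℂ (p k)).re

/-- `ℭ₊` : the interior of the dual cone. -/
def Cplus (d : ℕ) (Λ : Finset (Fin d → ℤ)) : Set ((Fin d → ℤ) → ℂ) :=
  {c | IsCoeff d Λ c ∧ ∀ p ∈ Pbar d Λ, p ≠ 0 → 0 < pair d Λ c p}

/-- `ℭ̄₊` : the closed dual cone. -/
def Cbar (d : ℕ) (Λ : Finset (Fin d → ℤ)) : Set ((Fin d → ℤ) → ℂ) :=
  {c | IsCoeff d Λ c ∧ ∀ p ∈ Pbar d Λ, 0 ≤ pair d Λ c p}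

/-- The dual functional J_P(Q) = ⟨c,q⟩ − ∫ P log Q dm. -/
def J (d : ℕ) (Λ : Finset (Fin d → ℤ)) (c P Q : (Fin d → ℤ) → ℂ) : ℝ :=
  pair d Λ c Q - ∫ θ, eval d Λ P θ * Real.log (eval d Λ Q θ) ∂(dm d)

/-- Covariance matching for an absolutely continuous measure Φ dm:
`c_k = ∫ e^{i(k,θ)} Φ(θ) dm(θ)` for all k ∈ Λ. -/
def Matches (d : ℕ) (Λ : Finset (Fin d → ℤ)) (c : (Fin d → ℤ) → ℂ)
    (Φ : (Fin d → ℝ) → ℝ) : Prop :=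
  ∀ k ∈ Λ, c k = ∫ θ, Complex.exp ((dotP d k θ : ℂ) * Complex.I) * (Φ θ : ℂ) ∂(dm d)

/-- The sup-norm ‖Q‖_∞ = sup_{θ ∈ 𝕋^d} |Q(e^{iθ})| of a trigonometric polynomial. -/
def supNorm (d : ℕ) (Λ : Finset (Fin d → ℤ)) (p : (Fin d → ℤ) → ℂ) : ℝ :=
  sSup ((fun θ => |eval d Λ p θ|) '' Td d)

/-- Lebesgue measure on `(-π, π]`. -/
def arc : Measure ℝ := volume.restrict (Ioc (-Real.pi) Real.pi)

instance : IsFiniteMeasure arc := by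
  unfold arc; infer_instance

theorem ae_eval_circleMap_ne_zero {p : Polynomial ℂ} (hp : p ≠ 0) :
    ∀ᵐ t ∂arc, p.eval (circleMap 0 1 t) ≠ 0 := by
  refine ae_restrict_of_ae ?_
  have hc : (circleMap 0 1 ⁻¹' {z | p.IsRoot z}).Countable :=
    (Polynomial.finite_setOfPred_isRoot hp).countable.preimage_circleMap 0 one_ne_zero
  filter_upwards [hc.ae_notMem volume] with t ht using ht

theorem periodic_log_norm_eval (p : Polynomial ℂ) :
    Function.Periodic (fun t ↦ Real.log ‖p.eval (circleMap 0 1 t)‖) (2 * Real.pi) := fun t ↦ by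
  simp only [periodic_circleMap 0 1 t]

theorem integrable_log_norm_eval (p : Polynomial ℂ) :
    Integrable (fun t ↦ Real.log ‖p.eval (circleMap 0 1 t)‖) arc := by
  have h := (periodic_log_norm_eval p).intervalIntegrable₀ (by positivity)
    p.intervalIntegrable_mahlerMeasure (-Real.pi) Real.pi
  exact (intervalIntegrable_iff_integrableOn_Ioc_of_le (by linarith [Real.pi_pos])).1 h

theorem log_norm_leadingCoeff_le_integral {p : Polynomial ℂ} (hp : p ≠ 0) :
    2 * Real.pi * Real.log ‖p.leadingCoeff‖ ≤
      ∫ t, Real.log ‖p.eval (circleMap 0 1 t)‖ ∂arc := by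
  have h := Real.log_le_log (norm_pos_iff.2 (Polynomial.leadingCoeff_ne_zero.2 hp))
    p.leadingCoeff_le_mahlerMeasure
  rw [← Polynomial.logMahlerMeasure_eq_log_MahlerMeasure, Polynomial.logMahlerMeasure_def,
    Real.circleAverage_def, smul_eq_mul, inv_mul_eq_div, le_div_iff₀ (by positivity)] at h
  have hper := (periodic_log_norm_eval p).intervalIntegral_add_eq 0 (-Real.pi)
  rw [zero_add, show -Real.pi + 2 * Real.pi = Real.pi by ring] at hper
  rw [arc, ← intervalIntegral.integral_of_le (by linarith [Real.pi_pos]), ← hper]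
  linarith

/-- The point of the torus in `ℂⁿ` with angles `θ`. -/
def torusPt {n : ℕ} (θ : Fin n → ℝ) : Fin n → ℂ := fun j ↦ circleMap 0 1 (θ j)

theorem torusPt_cons {n : ℕ} (t : ℝ) (θ : Fin n → ℝ) :
    torusPt (Fin.cons t θ : Fin (n + 1) → ℝ) = Fin.cons (circleMap 0 1 t) (torusPt θ) := by
  ext j
  refine Fin.cases ?_ (fun i ↦ ?_) j <;> simp [torusPt]

theorem continuous_eval_torusPt {n : ℕ} (F : MvPolynomial (Fin n) ℂ) :
    Continuous fun θ ↦ MvPolynomial.eval (torusPt θ) F :=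
  F.continuous_eval.comp (by unfold torusPt; fun_prop)

theorem exists_norm_eval_torusPt_le {n : ℕ} (F : MvPolynomial (Fin n) ℂ) :
    ∃ M, ∀ θ, ‖MvPolynomial.eval (torusPt θ) F‖ ≤ M := by
  refine ⟨∑ m ∈ F.support, ‖F.coeff m‖, fun θ ↦ ?_⟩
  rw [MvPolynomial.eval_eq]
  refine (norm_sum_le _ _).trans (Finset.sum_le_sum fun m _ ↦ ?_)
  simp [torusPt, norm_prod]

theorem log_norm_eval_torusPt {n : ℕ} (F : MvPolynomial (Fin n) ℂ) (hF : F ≠ 0) :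
    (∀ᵐ θ ∂Measure.pi fun _ : Fin n ↦ arc, MvPolynomial.eval (torusPt θ) F ≠ 0) ∧
      Integrable (fun θ ↦ Real.log ‖MvPolynomial.eval (torusPt θ) F‖)
        (Measure.pi fun _ : Fin n ↦ arc) := by
  induction n with
  | zero =>
    obtain ⟨a, rfl⟩ : ∃ a, F = MvPolynomial.C a := ⟨_, MvPolynomial.eq_C_of_isEmpty F⟩
    have ha : a ≠ 0 := by rintro rfl; simp at hF
    simp [ha]
  | succ n ih =>
    set f := MvPolynomial.finSuccEquiv ℂ n F with hf
    have hf0 : f ≠ 0 := by simpa [hf] using hF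
    obtain ⟨hne, hint⟩ := ih f.leadingCoeff (Polynomial.leadingCoeff_ne_zero.2 hf0)
    obtain ⟨M, hM⟩ := exists_norm_eval_torusPt_le F
    let slice (s : Fin n → ℝ) : Polynomial ℂ := f.map (MvPolynomial.eval (torusPt s))
    have hslice (t : ℝ) (s : Fin n → ℝ) :
        MvPolynomial.eval (torusPt (Fin.cons t s : Fin (n + 1) → ℝ)) F =
          (slice s).eval (circleMap 0 1 t) := by
      rw [torusPt_cons, MvPolynomial.eval_eq_eval_mv_eval']
    have hlead : ∀ᵐ s ∂Measure.pi fun _ : Fin n ↦ arc, slice s ≠ 0 ∧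
        (slice s).leadingCoeff = MvPolynomial.eval (torusPt s) f.leadingCoeff := by
      filter_upwards [hne] with s hs
      have h := Polynomial.leadingCoeff_map_of_leadingCoeff_ne_zero (p := f) _ hs
      exact ⟨fun h0 ↦ hs (by rw [← h]; simp [slice] at h0; simp [h0]), h⟩
    let e := MeasurableEquiv.piFinSuccAbove (fun _ : Fin (n + 1) ↦ ℝ) 0
    have he : MeasurePreserving e.symm (arc.prod (Measure.pi fun _ : Fin n ↦ arc))
        (Measure.pi fun _ : Fin (n + 1) ↦ arc) :=
      (measurePreserving_piFinSuccAbove (fun _ : Fin (n + 1) ↦ arc) 0).symm e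
    have hes (z : ℝ × (Fin n → ℝ)) : e.symm z = Fin.cons z.1 z.2 := by
      simp [e, MeasurableEquiv.piFinSuccAbove, Fin.consEquiv]
    have hcont : Continuous fun z : ℝ × (Fin n → ℝ) ↦
        MvPolynomial.eval (torusPt (Fin.cons z.1 z.2 : Fin (n + 1) → ℝ)) F :=
      (continuous_eval_torusPt F).comp (Continuous.finCons (A := fun _ ↦ ℝ) continuous_fst continuous_snd)
    have hmeas : Measurable fun z : ℝ × (Fin n → ℝ) ↦
        Real.log ‖MvPolynomial.eval (torusPt (Fin.cons z.1 z.2 : Fin (n + 1) → ℝ)) F‖ :=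
      hcont.norm.measurable.log
    have hset : MeasurableSet {θ | MvPolynomial.eval (torusPt θ) F ≠ 0} :=
      (isOpen_ne_fun (continuous_eval_torusPt F) continuous_const).measurableSet
    have hset' : MeasurableSet {z : ℝ × (Fin n → ℝ) |
        MvPolynomial.eval (torusPt (Fin.cons z.1 z.2 : Fin (n + 1) → ℝ)) F ≠ 0} :=
      (isOpen_ne_fun hcont continuous_const).measurableSet
    constructor
    · rw [← he.map_eq, ae_map_iff he.measurable.aemeasurable hset]
      simp only [hes]
      rw [Measure.ae_prod_iff_ae_ae hset', Measure.ae_ae_comm hset']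
      filter_upwards [hlead] with s hs
      simpa only [hslice] using ae_eval_circleMap_ne_zero hs.1
    · rw [← he.integrable_comp_emb e.symm.measurableEmbedding]
      simp only [Function.comp_def, hes]
      rw [integrable_prod_iff' hmeas.aestronglyMeasurable]
      simp only [hslice]
      refine ⟨.of_forall fun s ↦ integrable_log_norm_eval _, ?_⟩
      refine ((integrable_const (4 * Real.pi * |M|)).sub (hint.const_mul (2 * Real.pi))).mono' ?_ ?_
      · have := hmeas.norm.stronglyMeasurable.integral_prod_left' (μ := arc)
        simpa only [hslice] using this.aestronglyMeasurable
      · filter_upwards [hlead, hne] with s hs hs'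
        have hI := integrable_log_norm_eval (slice s)
        have hJ := log_norm_leadingCoeff_le_integral hs.1
        rw [hs.2] at hJ
        rw [Real.norm_of_nonneg (integral_nonneg fun _ ↦ norm_nonneg _)]
        have hvol : arc.real univ = 2 * Real.pi := by
          simp [arc, Measure.real, Real.pi_pos.le]; ring
        calc ∫ t, ‖Real.log ‖(slice s).eval (circleMap 0 1 t)‖‖ ∂arc
            ≤ ∫ t, (2 * |M| - Real.log ‖(slice s).eval (circleMap 0 1 t)‖) ∂arc := by
              refine integral_mono hI.norm ((integrable_const _).sub hI) fun t ↦ ?_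
              have h1 := (Real.log_le_self (norm_nonneg _)).trans
                ((hslice t s ▸ hM (Fin.cons t s)).trans (le_abs_self M))
              simp only [Real.norm_eq_abs]
              exact abs_le'.2 ⟨by linarith, by linarith [abs_nonneg M]⟩
          _ = 4 * Real.pi * |M| - ∫ t, Real.log ‖(slice s).eval (circleMap 0 1 t)‖ ∂arc := by
              rw [integral_sub (integrable_const _) hI, integral_const, hvol, smul_eq_mul]
              ring
          _ ≤ _ := by simp only [Pi.sub_apply]; linarith

/-- The complex trigonometric sum whose real part is `eval`. -/
def trigSum (d : ℕ) (Λ : Finset (Fin d → ℤ)) (p : (Fin d → ℤ) → ℂ) (θ : Fin d → ℝ) : ℂ :=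
  ∑ k ∈ Λ, p k * Complex.exp (-(dotP d k θ : ℂ) * Complex.I)

section

variable {d : ℕ} {Λ : Finset (Fin d → ℤ)} {p : (Fin d → ℤ) → ℂ}

/-- The exponent `N - k` as a multi-index. -/
def shiftExp (N : ℤ) (k : Fin d → ℤ) : Fin d →₀ ℕ :=
  Finsupp.equivFunOnFinite.symm fun j ↦ (N - k j).toNat

/-- The polynomial obtained from a trigonometric polynomial by multiplying it with a monomial. -/
def shiftPoly (Λ : Finset (Fin d → ℤ)) (p : (Fin d → ℤ) → ℂ) (N : ℤ) :
    MvPolynomial (Fin d) ℂ :=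
  ∑ k ∈ Λ, MvPolynomial.monomial (shiftExp N k) (p k)

theorem exists_forall_coord_le (Λ : Finset (Fin d → ℤ)) : ∃ N : ℤ, ∀ k ∈ Λ, ∀ j, k j ≤ N := by
  refine ⟨∑ k ∈ Λ, ∑ j, |k j|, fun k hk j ↦ (le_abs_self _).trans ?_⟩
  calc |k j| ≤ ∑ j, |k j| :=
        Finset.single_le_sum (f := fun j ↦ |k j|) (fun _ _ ↦ abs_nonneg _) (Finset.mem_univ j)
    _ ≤ _ := Finset.single_le_sum (f := fun k : Fin d → ℤ ↦ ∑ j, |k j|)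
        (fun _ _ ↦ Finset.sum_nonneg fun _ _ ↦ abs_nonneg _) hk

theorem norm_eval_shiftPoly {N : ℤ} (hN : ∀ k ∈ Λ, ∀ j, k j ≤ N) (θ : Fin d → ℝ) :
    ‖MvPolynomial.eval (torusPt θ) (shiftPoly Λ p N)‖ = ‖trigSum d Λ p θ‖ := by
  have h : MvPolynomial.eval (torusPt θ) (shiftPoly Λ p N) =
      Complex.exp ((∑ j, N * θ j : ℝ) * Complex.I) * trigSum d Λ p θ := by
    rw [shiftPoly, trigSum, map_sum, Finset.mul_sum]
    refine Finset.sum_congr rfl fun k hk ↦ ?_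
    rw [MvPolynomial.eval_monomial, Finsupp.prod_fintype _ _ (by simp), mul_left_comm,
      ← Complex.exp_add]
    congr 1
    have hj (j : Fin d) : torusPt θ j ^ shiftExp N k j =
        Complex.exp (((N : ℂ) - k j) * θ j * Complex.I) := by
      have hcast : (((N - k j).toNat : ℕ) : ℂ) = (N : ℂ) - k j := by
        have := Int.toNat_of_nonneg (sub_nonneg.2 (hN k hk j))
        calc (((N - k j).toNat : ℕ) : ℂ) = (((N - k j).toNat : ℤ) : ℂ) := by push_cast; rfl
          _ = _ := by rw [this]; push_cast; rfl
      simp only [torusPt, circleMap_zero, Complex.ofReal_one, one_mul, shiftExp,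
        Finsupp.equivFunOnFinite_symm_apply_apply]
      rw [← Complex.exp_nat_mul, hcast, mul_assoc]
    simp only [hj]
    rw [← Complex.exp_sum]
    congr 1
    simp only [dotP]
    push_cast
    rw [← add_mul, ← sub_eq_add_neg, ← Finset.sum_sub_distrib, Finset.sum_mul]
    exact Finset.sum_congr rfl fun j _ ↦ by ring
  rw [h, norm_mul, Complex.norm_exp_ofReal_mul_I, one_mul]

theorem shiftPoly_ne_zero (hp : IsCoeff d Λ p) (hp0 : p ≠ 0) {N : ℤ}
    (hN : ∀ k ∈ Λ, ∀ j, k j ≤ N) : shiftPoly Λ p N ≠ 0 := by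
  obtain ⟨k, hk⟩ := Function.ne_iff.1 hp0
  have hkΛ : k ∈ Λ := by_contra fun h ↦ hk (hp.1 k h)
  intro h
  refine hk ?_
  have hcoeff := congrArg (MvPolynomial.coeff (shiftExp N k)) h
  rw [shiftPoly, MvPolynomial.coeff_sum, Finset.sum_eq_single_of_mem k hkΛ] at hcoeff
  · simpa using hcoeff
  · intro l hl hlk
    rw [MvPolynomial.coeff_monomial, if_neg]
    intro heq
    refine hlk (funext fun j ↦ ?_)
    have hj := DFunLike.congr_fun heq j
    simp only [shiftExp, Finsupp.equivFunOnFinite_symm_apply_apply] at hj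
    have := hN k hkΛ j
    have := hN l hl j
    omega

theorem ofReal_eval (hΛ : ∀ k ∈ Λ, -k ∈ Λ) (hp : IsCoeff d Λ p) (θ : Fin d → ℝ) :
    (eval d Λ p θ : ℂ) = trigSum d Λ p θ := by
  refine Complex.conj_eq_iff_re.1 ?_
  rw [map_sum]
  refine Finset.sum_nbij' (fun k ↦ -k) (fun k ↦ -k) hΛ hΛ (by simp) (by simp) fun k _ ↦ ?_
  have hdot : dotP d (-k) θ = -dotP d k θ := by simp [dotP]
  rw [map_mul, ← hp.2, ← Complex.exp_conj, hdot]
  simp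

theorem abs_eval (hΛ : ∀ k ∈ Λ, -k ∈ Λ) (hp : IsCoeff d Λ p) (θ : Fin d → ℝ) :
    |eval d Λ p θ| = ‖trigSum d Λ p θ‖ := by
  rw [← ofReal_eval hΛ hp, Complex.norm_real, Real.norm_eq_abs]

theorem dm_eq (d : ℕ) :
    dm d = (ENNReal.ofReal ((2 * Real.pi) ^ d))⁻¹ • Measure.pi fun _ : Fin d ↦ arc := by
  rw [dm, Td, volume_pi, Measure.restrict_pi_pi]
  rfl

theorem ofReal_two_pi_pow_inv_ne_top (d : ℕ) :
    (ENNReal.ofReal ((2 * Real.pi) ^ d))⁻¹ ≠ ⊤ :=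
  ENNReal.inv_ne_top.2 (ENNReal.ofReal_pos.2 (by positivity)).ne'

instance (d : ℕ) : IsFiniteMeasure (dm d) := by
  rw [dm_eq]
  exact Measure.smul_finite _ (ofReal_two_pi_pow_inv_ne_top d)

theorem ae_mem_Td (d : ℕ) : ∀ᵐ θ ∂dm d, θ ∈ Td d := by
  refine Measure.ae_smul_measure (ae_restrict_mem ?_) _
  exact MeasurableSet.univ_pi fun _ ↦ measurableSet_Ioc

theorem log_eval_integrable (hΛ : ∀ k ∈ Λ, -k ∈ Λ) (hp : IsCoeff d Λ p) (hp0 : p ≠ 0) :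
    (∀ᵐ θ ∂dm d, eval d Λ p θ ≠ 0) ∧ Integrable (fun θ ↦ Real.log (eval d Λ p θ)) (dm d) := by
  obtain ⟨N, hN⟩ := exists_forall_coord_le Λ
  obtain ⟨hne, hint⟩ := log_norm_eval_torusPt _ (shiftPoly_ne_zero hp hp0 hN)
  rw [dm_eq]
  constructor
  · refine Measure.ae_smul_measure ?_ _
    filter_upwards [hne] with θ hθ
    rw [← norm_ne_zero_iff, norm_eval_shiftPoly hN, ← abs_eval hΛ hp] at hθ
    exact abs_ne_zero.1 hθ
  · refine Integrable.smul_measure ?_ (ofReal_two_pi_pow_inv_ne_top d)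
    refine hint.congr (.of_forall fun θ ↦ ?_)
    simp only
    rw [norm_eval_shiftPoly hN, ← abs_eval hΛ hp, Real.log_abs]

theorem abs_eval_le (p : (Fin d → ℤ) → ℂ) (θ : Fin d → ℝ) :
    |eval d Λ p θ| ≤ ∑ k ∈ Λ, ‖p k‖ := by
  refine (Complex.abs_re_le_norm _).trans ((norm_sum_le _ _).trans (Finset.sum_le_sum fun k _ ↦ ?_))
  rw [norm_mul, ← Complex.ofReal_neg, Complex.norm_exp_ofReal_mul_I, mul_one]

theorem continuous_eval (p : (Fin d → ℤ) → ℂ) : Continuous (eval d Λ p) := by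
  unfold eval dotP
  fun_prop

theorem continuous_eval_coeff (θ : Fin d → ℝ) : Continuous fun p ↦ eval d Λ p θ := by
  unfold eval
  fun_prop

theorem continuous_pair (c : (Fin d → ℤ) → ℂ) : Continuous (pair d Λ c) := by
  unfold pair
  fun_prop

theorem supNorm_le (p : (Fin d → ℤ) → ℂ) : supNorm d Λ p ≤ ∑ k ∈ Λ, ‖p k‖ := by
  refine Real.sSup_le ?_ (Finset.sum_nonneg fun _ _ ↦ norm_nonneg _)
  rintro _ ⟨θ, -, rfl⟩
  exact abs_eval_le p θ

theorem eval_le_supNorm (p : (Fin d → ℤ) → ℂ) {θ : Fin d → ℝ} (hθ : θ ∈ Td d) :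
    eval d Λ p θ ≤ supNorm d Λ p := by
  refine (le_abs_self _).trans (le_csSup ⟨∑ k ∈ Λ, ‖p k‖, ?_⟩ (mem_image_of_mem _ hθ))
  rintro _ ⟨θ, -, rfl⟩
  exact abs_eval_le p θ

theorem eval_smul (r : ℝ) (p : (Fin d → ℤ) → ℂ) (θ : Fin d → ℝ) :
    eval d Λ ((r : ℂ) • p) θ = r * eval d Λ p θ := by
  simp only [eval, Pi.smul_apply, smul_eq_mul, mul_assoc]
  rw [← Finset.mul_sum, Complex.re_ofReal_mul]

theorem pair_smul (r : ℝ) (c p : (Fin d → ℤ) → ℂ) :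
    pair d Λ c ((r : ℂ) • p) = r * pair d Λ c p := by
  simp only [pair, Pi.smul_apply, smul_eq_mul, map_mul, Complex.conj_ofReal, mul_left_comm _ (r : ℂ)]
  rw [← Finset.mul_sum, Complex.re_ofReal_mul]

theorem smul_mem_Pbar {r : ℝ} (hr : 0 ≤ r) (hp : p ∈ Pbar d Λ) : (r : ℂ) • p ∈ Pbar d Λ := by
  refine ⟨⟨fun k hk ↦ by simp [hp.1.1 k hk], fun k ↦ by simp [hp.1.2 k]⟩, fun θ hθ ↦ ?_⟩
  rw [eval_smul]
  exact mul_nonneg hr (hp.2 θ hθ)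

theorem isClosed_Pbar : IsClosed (Pbar d Λ) := by
  simp only [Pbar, IsCoeff, ofPred_and, ofPred_forall]
  refine ((isClosed_iInter fun k ↦ isClosed_iInter fun _ ↦ ?_).inter
    (isClosed_iInter fun k ↦ ?_)).inter (isClosed_iInter fun θ ↦ isClosed_iInter fun _ ↦ ?_)
  · exact isClosed_eq (by fun_prop) (by fun_prop)
  · exact isClosed_eq (by fun_prop) (by fun_prop)
  · exact isClosed_le continuous_const (continuous_eval_coeff θ)

theorem isCompact_Pbar_inter_sum_norm_eq_one :
    IsCompact (Pbar d Λ ∩ {p | ∑ k ∈ Λ, ‖p k‖ = 1}) := by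
  refine (isCompact_univ_pi fun _ : Fin d → ℤ ↦ isCompact_closedBall (0 : ℂ) 1).of_isClosed_subset
    (isClosed_Pbar.inter (isClosed_eq (by fun_prop) continuous_const)) ?_
  rintro p ⟨hp, hp1⟩ k -
  rw [mem_closedBall_zero_iff]
  by_cases hk : k ∈ Λ
  · exact (Finset.single_le_sum (f := fun k ↦ ‖p k‖) (fun _ _ ↦ norm_nonneg _) hk).trans hp1.le
  · simp [hp.1.1 k hk]

theorem sum_norm_pos (hp : IsCoeff d Λ p) (hp0 : p ≠ 0) : 0 < ∑ k ∈ Λ, ‖p k‖ := by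
  obtain ⟨k, hk⟩ := Function.ne_iff.1 hp0
  exact Finset.sum_pos' (fun _ _ ↦ norm_nonneg _)
    ⟨k, by_contra fun h ↦ hk (hp.1 k h), norm_pos_iff.2 hk⟩

theorem exists_pos_mul_sum_norm_le_pair {c : (Fin d → ℤ) → ℂ} (hc : c ∈ Cplus d Λ) :
    ∃ ε > (0 : ℝ), ∀ q ∈ Pbar d Λ, ε * ∑ k ∈ Λ, ‖q k‖ ≤ pair d Λ c q := by
  have hpos : ∀ q ∈ Pbar d Λ ∩ {p | ∑ k ∈ Λ, ‖p k‖ = 1}, 0 < pair d Λ c q := fun q hq ↦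
    hc.2 q hq.1 (by rintro rfl; simpa using hq.2)
  obtain ⟨ε, hε, hle⟩ := isCompact_Pbar_inter_sum_norm_eq_one.exists_forall_le'
    (continuous_pair c).continuousOn hpos
  refine ⟨ε, hε, fun q hq ↦ ?_⟩
  obtain rfl | hq0 := eq_or_ne q 0
  · simp [pair]
  have hs := sum_norm_pos hq.1 hq0
  set s := ∑ k ∈ Λ, ‖q k‖ with hsdef
  have h := hle (((s⁻¹ : ℝ) : ℂ) • q) ⟨smul_mem_Pbar (inv_nonneg.2 hs.le) hq, by
    simp only [mem_ofPred_eq, Pi.smul_apply, smul_eq_mul, norm_mul, Complex.norm_real,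
      Real.norm_eq_abs, abs_of_pos (inv_pos.2 hs)]
    rw [← Finset.mul_sum, ← hsdef, inv_mul_cancel₀ hs.ne']⟩
  rwa [pair_smul, inv_mul_eq_div, le_div_iff₀ hs] at h

theorem integral_mul_log_eval_le (hΛ : ∀ k ∈ Λ, -k ∈ Λ) {q : (Fin d → ℤ) → ℂ}
    (hp : p ∈ Pbar d Λ) (hq : q ∈ Pbar d Λ) (hq0 : q ≠ 0) :
    ∫ θ, eval d Λ p θ * Real.log (eval d Λ q θ) ∂dm d ≤
      (∫ θ, eval d Λ p θ ∂dm d) * Real.log (supNorm d Λ q) := by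
  obtain ⟨hne, hint⟩ := log_eval_integrable hΛ hq.1 hq0
  have hbdd : ∀ᵐ θ ∂dm d, ‖eval d Λ p θ‖ ≤ ∑ k ∈ Λ, ‖p k‖ := .of_forall (abs_eval_le p)
  have hmeas := (continuous_eval (Λ := Λ) p).aestronglyMeasurable (μ := dm d)
  rw [← integral_mul_const]
  refine integral_mono_ae (hint.bdd_mul hmeas hbdd)
    ((Integrable.of_bound hmeas _ hbdd).mul_const _) ?_
  filter_upwards [hne, ae_mem_Td d] with θ hθ hmem
  exact mul_le_mul_of_nonneg_left
    (Real.log_le_log ((hq.2 θ hmem).lt_of_ne' hθ) (eval_le_supNorm q hmem)) (hp.2 θ hmem)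

end

/-- for fixed c ∈ ℭ₊ there is ε > 0 such that for all
(P,Q) ∈ (𝔓̄₊ \ {0}) × (𝔓̄₊ \ {0}),
J_P(Q) ≥ ε‖Q‖_∞ − (∫ P dm) log ‖Q‖_∞. -/
theorem statement8 (d : ℕ) (hd : 1 ≤ d) (Λ : Finset (Fin d → ℤ))
    (h0 : (0 : Fin d → ℤ) ∈ Λ) (hΛ : ∀ k ∈ Λ, -k ∈ Λ)
    (c : (Fin d → ℤ) → ℂ) (hc : c ∈ Cplus d Λ) :
    ∃ ε > (0 : ℝ), ∀ P ∈ Pbar d Λ \ {0}, ∀ Q ∈ Pbar d Λ \ {0},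
      ε * supNorm d Λ Q - (∫ θ, eval d Λ P θ ∂(dm d)) * Real.log (supNorm d Λ Q)
        ≤ J d Λ c P Q := by
  obtain ⟨ε, hε, hle⟩ := exists_pos_mul_sum_norm_le_pair hc
  refine ⟨ε, hε, fun P hP Q hQ ↦ ?_⟩
  exact sub_le_sub ((mul_le_mul_of_nonneg_left (supNorm_le Q) hε.le).trans (hle Q hQ.1))
    (integral_mul_log_eval_le hΛ hP.1 hQ.1 hQ.2)

end RCE
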